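/- Fréchet–Hoeffding solution in dimension one: let μ1, μ2 be Borel probability measures on ℝ with cumulative distribution functions F1, F2 and quantile functions F1⁻¹, F2⁻¹ (left-continuous generalized inverses), and let c : ℝ × ℝ → ℝ be bounded continuous and supermodular, i.e. c(x, y) + c(x', y') ≥ c(x, y') + c(x', y) whenever x ≤ x' and y ≤ y'. Then the supremum of ∫ c dP over all couplings P of (μ1, μ2) equals ∫₀¹ c(F1⁻¹(u), F2⁻¹(u)) du, and it is attained by the comonotone coupling, namely the pushforward of Lebesgue measure on (0,1) by the map u ↦ (F1⁻¹(u), F2⁻¹(u)). -/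

import Mathlib

open MeasureTheory

noncomputable section

/-- A coupling of measures on `ℝ`. -/
def IsCoupling (μ1 μ2 : Measure ℝ) (P : Measure (ℝ × ℝ)) : Prop :=
  P.map Prod.fst = μ1 ∧ P.map Prod.snd = μ2

/-- The cumulative distribution function of a Borel measure on `ℝ`. -/
def cdf (μ : Measure ℝ) (x : ℝ) : ℝ :=
  (μ (Set.Iic x)).toReal

/-- The quantile function (left-continuous generalized inverse of the cdf). -/
def quantile (μ : Measure ℝ) (u : ℝ) : ℝ :=
  sInf {x : ℝ | u ≤ cdf μ x}

/-- The comonotone coupling: the pushforward of Lebesgue measure on `(0,1)` by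
`u ↦ (F1⁻¹(u), F2⁻¹(u))`. -/
def comonotoneCoupling (μ1 μ2 : Measure ℝ) : Measure (ℝ × ℝ) :=
  (volume.restrict (Set.Ioo (0 : ℝ) 1)).map (fun u => (quantile μ1 u, quantile μ2 u))

open Filter Topology

namespace FrechetHoeffding

lemma cdf_eq_probabilityTheory_cdf (μ : Measure ℝ) [IsProbabilityMeasure μ] (x : ℝ) :
    _root_.cdf μ x = ProbabilityTheory.cdf μ x := by
  rw [ProbabilityTheory.cdf_eq_real]; rfl

lemma quantile_le_iff (μ : Measure ℝ) [IsProbabilityMeasure μ] {u : ℝ}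
    (hu : u ∈ Set.Ioo (0 : ℝ) 1) (x : ℝ) : quantile μ u ≤ x ↔ u ≤ _root_.cdf μ x := by
  have hmono : Monotone (_root_.cdf μ) := fun a b hab => by
    simpa only [cdf_eq_probabilityTheory_cdf] using ProbabilityTheory.monotone_cdf μ hab
  have hbdd : BddBelow {x : ℝ | u ≤ _root_.cdf μ x} := by
    obtain ⟨a, ha⟩ :=
      ((ProbabilityTheory.tendsto_cdf_atBot μ).eventually (gt_mem_nhds hu.1)).exists
    refine ⟨a, fun y hy => ?_⟩
    by_contra! hya
    have hle := hmono hya.le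
    rw [cdf_eq_probabilityTheory_cdf μ a] at hle
    exact absurd (hy.trans hle) (not_le.2 ha)
  have hne : {x : ℝ | u ≤ _root_.cdf μ x}.Nonempty := by
    obtain ⟨a, ha⟩ :=
      ((ProbabilityTheory.tendsto_cdf_atTop μ).eventually (lt_mem_nhds hu.2)).exists
    exact ⟨a, by simpa only [Set.mem_ofPred_eq, cdf_eq_probabilityTheory_cdf] using ha.le⟩
  refine ⟨fun h => ?_, fun h => csInf_le hbdd h⟩
  refine le_trans ?_ (hmono h)
  have hright : Tendsto (_root_.cdf μ) (𝓝[>] (quantile μ u))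
      (𝓝 (_root_.cdf μ (quantile μ u))) := by
    have hcont := ((ProbabilityTheory.cdf μ).right_continuous (quantile μ u)).mono
      Set.Ioi_subset_Ici_self
    rwa [← funext (cdf_eq_probabilityTheory_cdf μ)] at hcont
  refine ge_of_tendsto hright ?_
  filter_upwards [self_mem_nhdsWithin] with y hy
  obtain ⟨z, hz, hzy⟩ := exists_lt_of_csInf_lt hne hy
  exact le_trans hz (hmono hzy.le)

lemma monotoneOn_quantile (μ : Measure ℝ) [IsProbabilityMeasure μ] :
    MonotoneOn (quantile μ) (Set.Ioo (0 : ℝ) 1) := fun _ ha _ hb hab =>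
  (quantile_le_iff μ ha _).2 (hab.trans ((quantile_le_iff μ hb _).1 le_rfl))

lemma aemeasurable_quantile (μ : Measure ℝ) [IsProbabilityMeasure μ] :
    AEMeasurable (quantile μ) (volume.restrict (Set.Ioo (0 : ℝ) 1)) :=
  aemeasurable_restrict_of_monotoneOn measurableSet_Ioo (monotoneOn_quantile μ)

lemma map_quantile (μ : Measure ℝ) [IsProbabilityMeasure μ] :
    (volume.restrict (Set.Ioo (0 : ℝ) 1)).map (quantile μ) = μ := by
  refine Measure.ext_of_Iic _ _ fun x => ?_
  rw [Measure.map_apply_of_aemeasurable (aemeasurable_quantile μ) measurableSet_Iic,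
    Measure.restrict_apply' measurableSet_Ioo]
  have hset : quantile μ ⁻¹' Set.Iic x ∩ Set.Ioo 0 1
      = Set.Iic (_root_.cdf μ x) ∩ Set.Ioo 0 1 := by
    ext u
    simp only [Set.mem_inter_iff, Set.mem_preimage, Set.mem_Iic]
    exact and_congr_left fun hu => quantile_le_iff μ hu x
  have hle : _root_.cdf μ x ≤ 1 := by
    rw [cdf_eq_probabilityTheory_cdf]; exact ProbabilityTheory.cdf_le_one μ x
  rw [hset, ← Measure.restrict_apply' measurableSet_Ioo,
    Measure.restrict_congr_set Ioo_ae_eq_Ioc, Measure.restrict_apply' measurableSet_Ioc,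
    Set.inter_comm, Set.Ioc_inter_Iic, min_eq_right hle, Real.volume_Ioc, sub_zero]
  exact ENNReal.ofReal_toReal (measure_ne_top _ _)

lemma aemeasurable_quantile_prodMk (μ1 μ2 : Measure ℝ) [IsProbabilityMeasure μ1]
    [IsProbabilityMeasure μ2] :
    AEMeasurable (fun u => (quantile μ1 u, quantile μ2 u))
      (volume.restrict (Set.Ioo (0 : ℝ) 1)) :=
  (aemeasurable_quantile μ1).prodMk (aemeasurable_quantile μ2)

lemma isCoupling_comonotoneCoupling (μ1 μ2 : Measure ℝ) [IsProbabilityMeasure μ1]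
    [IsProbabilityMeasure μ2] : IsCoupling μ1 μ2 (comonotoneCoupling μ1 μ2) := by
  have hmeas := aemeasurable_quantile_prodMk μ1 μ2
  constructor
  · rw [comonotoneCoupling, AEMeasurable.map_map_of_aemeasurable measurable_fst.aemeasurable hmeas]
    exact map_quantile μ1
  · rw [comonotoneCoupling, AEMeasurable.map_map_of_aemeasurable measurable_snd.aemeasurable hmeas]
    exact map_quantile μ2

instance isProbabilityMeasure_comonotoneCoupling (μ1 μ2 : Measure ℝ) [IsProbabilityMeasure μ1]
    [IsProbabilityMeasure μ2] : IsProbabilityMeasure (comonotoneCoupling μ1 μ2) := by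
  have : IsProbabilityMeasure (volume.restrict (Set.Ioo (0 : ℝ) 1)) := ⟨by simp⟩
  exact Measure.isProbabilityMeasure_map (aemeasurable_quantile_prodMk μ1 μ2)

/-- Among all couplings, the comonotone one gives the largest mass to products of upper sets. -/
lemma measure_prod_le_comonotoneCoupling {μ1 μ2 : Measure ℝ} [IsProbabilityMeasure μ1]
    [IsProbabilityMeasure μ2] {P : Measure (ℝ × ℝ)} (hP : IsCoupling μ1 μ2 P)
    {A B : Set ℝ} (hA : IsUpperSet A) (hB : IsUpperSet B)
    (hAm : MeasurableSet A) (hBm : MeasurableSet B) :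
    P (A ×ˢ B) ≤ comonotoneCoupling μ1 μ2 (A ×ˢ B) := by
  have hPA : P (A ×ˢ B) ≤ μ1 A := by
    rw [← hP.1, Measure.map_apply measurable_fst hAm]
    exact measure_mono fun p hp => hp.1
  have hPB : P (A ×ˢ B) ≤ μ2 B := by
    rw [← hP.2, Measure.map_apply measurable_snd hBm]
    exact measure_mono fun p hp => hp.2
  have hμ1 : μ1 A = volume (quantile μ1 ⁻¹' A ∩ Set.Ioo 0 1) := by
    rw [← Measure.restrict_apply' measurableSet_Ioo,
      ← Measure.map_apply_of_aemeasurable (aemeasurable_quantile μ1) hAm, map_quantile]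
  have hμ2 : μ2 B = volume (quantile μ2 ⁻¹' B ∩ Set.Ioo 0 1) := by
    rw [← Measure.restrict_apply' measurableSet_Ioo,
      ← Measure.map_apply_of_aemeasurable (aemeasurable_quantile μ2) hBm, map_quantile]
  rw [comonotoneCoupling, Measure.map_apply_of_aemeasurable
    (aemeasurable_quantile_prodMk μ1 μ2) (hAm.prod hBm), Measure.restrict_apply' measurableSet_Ioo]
  by_cases hsub : quantile μ1 ⁻¹' A ∩ Set.Ioo 0 1 ⊆ quantile μ2 ⁻¹' B
  · refine (hPA.trans_eq hμ1).trans (measure_mono fun u hu => ⟨⟨hu.1, hsub hu⟩, hu.2⟩)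
  · obtain ⟨u, hu, huB⟩ := Set.not_subset.1 hsub
    refine (hPB.trans_eq hμ2).trans (measure_mono fun v hv => ⟨⟨?_, hv.1⟩, hv.2⟩)
    rcases le_total u v with huv | hvu
    · exact hA (monotoneOn_quantile μ1 hu.2 hv.2 huv) hu.1
    · exact absurd (hB (monotoneOn_quantile μ2 hv.2 hu.2 hvu) hv.1) huB

lemma eq_add_sum_mixed_difference (g : ℕ → ℕ → ℝ) {N m l : ℕ} (hm : m ≤ N) (hl : l ≤ N) :
    g m l = g m 0 + g 0 l - g 0 0 + ∑ i ∈ Finset.range N, ∑ j ∈ Finset.range N,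
      (g (i + 1) (j + 1) - g i (j + 1) - g (i + 1) j + g i j) *
        (if i < m ∧ j < l then 1 else 0) := by
  have hfilter (k : ℕ) (hk : k ≤ N) (f : ℕ → ℝ) :
      ∑ i ∈ Finset.range N, (if i < k then f i else 0) = ∑ i ∈ Finset.range k, f i := by
    rw [← Finset.sum_filter]
    congr 1
    ext i
    simp only [Finset.mem_filter, Finset.mem_range]
    omega
  have hinner (i : ℕ) : ∑ j ∈ Finset.range N,
      (g (i + 1) (j + 1) - g i (j + 1) - g (i + 1) j + g i j) *
        (if i < m ∧ j < l then (1 : ℝ) else 0) =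
      if i < m then (g (i + 1) l - g (i + 1) 0) - (g i l - g i 0) else 0 := by
    by_cases hi : i < m
    · simp only [hi, true_and, mul_ite, mul_one, mul_zero, if_true]
      rw [hfilter l hl, ← Finset.sum_range_sub (g (i + 1)), ← Finset.sum_range_sub (g i),
        ← Finset.sum_sub_distrib]
      exact Finset.sum_congr rfl fun j _ => by ring
    · simp [hi]
  rw [Finset.sum_congr rfl fun i _ => hinner i, hfilter m hm,
    Finset.sum_range_sub (fun i => g i l - g i 0)]
  ring

lemma integrable_comp_of_le {P : Measure (ℝ × ℝ)} [IsFiniteMeasure P] (f : ℕ → ℝ) {N : ℕ}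
    {K : ℝ × ℝ → ℕ} (hK : Measurable K) (hKN : ∀ x, K x ≤ N) :
    Integrable (fun p => f (K p)) P := by
  refine Integrable.of_bound ((measurable_of_countable f).comp hK).aestronglyMeasurable
    (∑ i ∈ Finset.range (N + 1), |f i|) (ae_of_all _ fun p => ?_)
  exact Finset.single_le_sum (f := fun i => |f i|) (fun i _ => abs_nonneg _)
    (Finset.mem_range.2 (Nat.lt_succ_of_le (hKN p)))

lemma integral_comp_eq_of_isCoupling {μ1 μ2 : Measure ℝ} {P : Measure (ℝ × ℝ)}
    [IsProbabilityMeasure P] (hP : IsCoupling μ1 μ2 P)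
    (g : ℕ → ℕ → ℝ) {N : ℕ} {K : ℝ → ℕ} (hK : Monotone K) (hKN : ∀ x, K x ≤ N) :
    ∫ p, g (K p.1) (K p.2) ∂P =
      (∫ x, g (K x) 0 ∂μ1) + (∫ y, g 0 (K y) ∂μ2) - g 0 0 +
      ∑ i ∈ Finset.range N, ∑ j ∈ Finset.range N,
        (g (i + 1) (j + 1) - g i (j + 1) - g (i + 1) j + g i j) *
          P.real ({x | i < K x} ×ˢ {y | j < K y}) := by
  have hKm : Measurable K := hK.measurable
  have hset (i : ℕ) : MeasurableSet {x | i < K x} := measurableSet_lt measurable_const hKm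
  have hind (i j : ℕ) : (fun p : ℝ × ℝ => if i < K p.1 ∧ j < K p.2 then (1 : ℝ) else 0) =
      ({x | i < K x} ×ˢ {y | j < K y}).indicator 1 := by
    funext p
    simp [Set.indicator_apply]
  have hindI (i j : ℕ) :
      Integrable (fun p : ℝ × ℝ => if i < K p.1 ∧ j < K p.2 then (1 : ℝ) else 0) P := by
    rw [hind]
    exact (integrable_const (1 : ℝ)).indicator ((hset i).prod (hset j))
  have hfst : Integrable (fun p : ℝ × ℝ => g (K p.1) 0) P :=
    integrable_comp_of_le (fun m => g m 0) (hKm.comp measurable_fst) fun p => hKN p.1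
  have hsnd : Integrable (fun p : ℝ × ℝ => g 0 (K p.2)) P :=
    integrable_comp_of_le (g 0) (hKm.comp measurable_snd) fun p => hKN p.2
  have hintfst : ∫ p, g (K p.1) 0 ∂P = ∫ x, g (K x) 0 ∂μ1 := by
    rw [← hP.1, integral_map measurable_fst.aemeasurable]
    exact ((measurable_of_countable fun m => g m 0).comp hKm).aestronglyMeasurable
  have hintsnd : ∫ p, g 0 (K p.2) ∂P = ∫ y, g 0 (K y) ∂μ2 := by
    rw [← hP.2, integral_map measurable_snd.aemeasurable]
    exact ((measurable_of_countable (g 0)).comp hKm).aestronglyMeasurable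
  have hadd : Integrable (fun p : ℝ × ℝ => g (K p.1) 0 + g 0 (K p.2)) P := hfst.add hsnd
  have hsub : Integrable (fun p : ℝ × ℝ => g (K p.1) 0 + g 0 (K p.2) - g 0 0) P :=
    hadd.sub (integrable_const _)
  rw [integral_congr_ae (ae_of_all P fun p : ℝ × ℝ =>
    eq_add_sum_mixed_difference g (hKN p.1) (hKN p.2))]
  rw [integral_add hsub
      (integrable_finsetSum _ fun i _ => integrable_finsetSum _ fun j _ =>
        (hindI i j).const_mul _),
    integral_sub hadd (integrable_const _), integral_add hfst hsnd, hintfst, hintsnd,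
    integral_finsetSum _ fun i _ => integrable_finsetSum _ fun j _ => (hindI i j).const_mul _]
  congr 1
  · simp
  · refine Finset.sum_congr rfl fun i _ => ?_
    rw [integral_finsetSum _ fun j _ => (hindI i j).const_mul _]
    refine Finset.sum_congr rfl fun j _ => ?_
    rw [integral_const_mul, hind, integral_indicator_one ((hset i).prod (hset j))]

lemma integral_comp_le_comonotoneCoupling {μ1 μ2 : Measure ℝ} [IsProbabilityMeasure μ1]
    [IsProbabilityMeasure μ2] {P : Measure (ℝ × ℝ)} [IsProbabilityMeasure P]
    (hP : IsCoupling μ1 μ2 P) (g : ℕ → ℕ → ℝ)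
    (hg : ∀ i j, 0 ≤ g (i + 1) (j + 1) - g i (j + 1) - g (i + 1) j + g i j)
    {N : ℕ} {K : ℝ → ℕ} (hK : Monotone K) (hKN : ∀ x, K x ≤ N) :
    ∫ p, g (K p.1) (K p.2) ∂P ≤ ∫ p, g (K p.1) (K p.2) ∂(comonotoneCoupling μ1 μ2) := by
  rw [integral_comp_eq_of_isCoupling hP g hK hKN,
    integral_comp_eq_of_isCoupling (isCoupling_comonotoneCoupling μ1 μ2) g hK hKN]
  have hup (i : ℕ) : IsUpperSet {x | i < K x} := fun _ _ hab ha => lt_of_lt_of_le ha (hK hab)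
  have hset (i : ℕ) : MeasurableSet {x | i < K x} :=
    measurableSet_lt measurable_const hK.measurable
  gcongr with i _ j _
  · exact hg i j
  · exact ENNReal.toReal_mono (measure_ne_top _ _)
      (measure_prod_le_comonotoneCoupling hP (hup i) (hup j) (hset i) (hset j))

/-- The index of the point of the grid `-n, -n + 1 / n, …, n` to which `x` is rounded up. -/
def gridIndex (n : ℕ) (x : ℝ) : ℕ := min ⌈(x + n) * n⌉₊ (2 * n * n)

/-- The point of index `k` in the grid `-n, -n + 1 / n, …, n`. -/
def gridPoint (n k : ℕ) : ℝ := k / n - n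

lemma monotone_gridIndex (n : ℕ) : Monotone (gridIndex n) := fun a b hab => by
  unfold gridIndex
  gcongr

lemma monotone_gridPoint (n : ℕ) : Monotone (gridPoint n) := fun a b hab => by
  unfold gridPoint
  gcongr

lemma tendsto_gridPoint_gridIndex (x : ℝ) :
    Tendsto (fun n : ℕ => gridPoint n (gridIndex n x)) atTop (𝓝 x) := by
  have hbounds : ∀ᶠ n : ℕ in atTop, x ≤ gridPoint n (gridIndex n x) ∧
      gridPoint n (gridIndex n x) ≤ x + 1 / (n : ℝ) := by
    obtain ⟨m, hm⟩ := exists_nat_gt |x|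
    filter_upwards [eventually_ge_atTop m, eventually_gt_atTop 0] with n hmn hn
    have hn' : (0 : ℝ) < n := Nat.cast_pos.2 hn
    have hxn : |x| ≤ n := hm.le.trans (Nat.cast_le.2 hmn)
    obtain ⟨hlow, hupp⟩ := abs_le.1 hxn
    have hindex : gridIndex n x = ⌈(x + n) * n⌉₊ := by
      refine min_eq_left (Nat.ceil_le.2 ?_)
      push_cast
      nlinarith
    have hceil := Nat.le_ceil ((x + n) * n)
    have hceil' := (Nat.ceil_lt_add_one (a := (x + n) * n) (by nlinarith)).le
    rw [hindex, gridPoint]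
    constructor
    · rw [le_sub_iff_add_le, le_div_iff₀ hn']
      exact hceil
    · rw [sub_le_iff_le_add, div_le_iff₀ hn']
      have : (x + 1 / n + n) * n = (x + n) * n + 1 := by field_simp; ring
      rwa [this]
  refine tendsto_of_tendsto_of_tendsto_of_le_of_le' tendsto_const_nhds ?_
    (hbounds.mono fun _ h => h.1) (hbounds.mono fun _ h => h.2)
  simpa using (tendsto_const_nhds (x := x)).add (tendsto_one_div_atTop_nhds_zero_nat (𝕜 := ℝ))

lemma tendsto_integral_grid {c : ℝ × ℝ → ℝ} (hc : Continuous c) {M : ℝ} (hM : ∀ p, |c p| ≤ M)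
    (P : Measure (ℝ × ℝ)) [IsFiniteMeasure P] :
    Tendsto (fun n : ℕ => ∫ p, c (gridPoint n (gridIndex n p.1), gridPoint n (gridIndex n p.2)) ∂P)
      atTop (𝓝 (∫ p, c p ∂P)) := by
  refine tendsto_integral_of_dominated_convergence (fun _ => M) (fun n => ?_)
    (integrable_const M) (fun n => ae_of_all _ fun p => hM _) (ae_of_all _ fun p => ?_)
  · have hgrid : Measurable fun x => gridPoint n (gridIndex n x) :=
      ((monotone_gridPoint n).comp (monotone_gridIndex n)).measurable
    exact (hc.measurable.comp
      ((hgrid.comp measurable_fst).prodMk (hgrid.comp measurable_snd))).aestronglyMeasurable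
  · exact (hc.tendsto p).comp
      ((tendsto_gridPoint_gridIndex p.1).prodMk_nhds (tendsto_gridPoint_gridIndex p.2))

end FrechetHoeffding

open FrechetHoeffding in
/-- Fréchet–Hoeffding in dimension one: for a bounded continuous supermodular cost, the
supremum of `∫ c dP` over couplings of `(μ1, μ2)` equals `∫₀¹ c(F1⁻¹(u), F2⁻¹(u)) du`, and it
is attained by the comonotone coupling. -/
theorem frechet_hoeffding (μ1 μ2 : Measure ℝ)
    [IsProbabilityMeasure μ1] [IsProbabilityMeasure μ2]
    (c : ℝ × ℝ → ℝ) (hc : Continuous c) (hcb : ∃ M : ℝ, ∀ p, |c p| ≤ M)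
    (hsuper : ∀ x x' y y' : ℝ, x ≤ x' → y ≤ y' →
      c (x, y') + c (x', y) ≤ c (x, y) + c (x', y')) :
    sSup {r : ℝ | ∃ P : Measure (ℝ × ℝ), IsProbabilityMeasure P ∧ IsCoupling μ1 μ2 P ∧
        r = ∫ p, c p ∂P} =
      ∫ u in Set.Ioo (0 : ℝ) 1, c (quantile μ1 u, quantile μ2 u) ∧
    IsCoupling μ1 μ2 (comonotoneCoupling μ1 μ2) ∧
    ∫ p, c p ∂(comonotoneCoupling μ1 μ2) =
      ∫ u in Set.Ioo (0 : ℝ) 1, c (quantile μ1 u, quantile μ2 u) ∧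
    ∀ P : Measure (ℝ × ℝ), IsProbabilityMeasure P → IsCoupling μ1 μ2 P →
      ∫ p, c p ∂P ≤ ∫ p, c p ∂(comonotoneCoupling μ1 μ2) := by
  have hval : ∫ p, c p ∂(comonotoneCoupling μ1 μ2) =
      ∫ u in Set.Ioo (0 : ℝ) 1, c (quantile μ1 u, quantile μ2 u) :=
    integral_map (aemeasurable_quantile_prodMk μ1 μ2) hc.aestronglyMeasurable
  have hopt : ∀ P : Measure (ℝ × ℝ), IsProbabilityMeasure P → IsCoupling μ1 μ2 P →
      ∫ p, c p ∂P ≤ ∫ p, c p ∂(comonotoneCoupling μ1 μ2) := by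
    intro P hPprob hP
    obtain ⟨M, hM⟩ := hcb
    refine le_of_tendsto_of_tendsto' (tendsto_integral_grid hc hM P)
      (tendsto_integral_grid hc hM (comonotoneCoupling μ1 μ2)) fun n => ?_
    refine integral_comp_le_comonotoneCoupling hP
      (fun i j => c (gridPoint n i, gridPoint n j)) (fun i j => ?_)
      (monotone_gridIndex n) (fun x => min_le_right _ _)
    have hle := hsuper _ _ _ _ (monotone_gridPoint n i.le_succ) (monotone_gridPoint n j.le_succ)
    simp only [Nat.succ_eq_add_one] at hle
    linarith
  refine ⟨IsGreatest.csSup_eq ⟨⟨comonotoneCoupling μ1 μ2, inferInstance,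
    isCoupling_comonotoneCoupling μ1 μ2, hval.symm⟩, ?_⟩,
    isCoupling_comonotoneCoupling μ1 μ2, hval, hopt⟩
  rintro r ⟨P, hPprob, hP, rfl⟩
  exact (hopt P hPprob hP).trans_eq hval
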